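/- Let p be an odd prime and let h be a minimal vanishing sorou whose relative order divides 2p. Then either h = {z, −z} for some root of unity z, or there is a root of unity z such that h equals the multiset {z, zν_p, zν_p^2, …, zν_p^{p−1}}. -/

import Mathlib

open Complex

noncomputable def nu (n : ℕ) : ℂ := Complex.exp (2 * Real.pi * Complex.I / n)

def IsRootOfUnity (z : ℂ) : Prop := ∃ n : ℕ, 0 < n ∧ z ^ n = 1

def IsSorou (h : Multiset ℂ) : Prop := h ≠ 0 ∧ ∀ z ∈ h, IsRootOfUnity z

noncomputable def rootOrder (z : ℂ) : ℕ := sInf {d : ℕ | 0 < d ∧ z ^ d = 1}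

noncomputable def sorouOrder (h : Multiset ℂ) : ℕ := (h.map rootOrder).lcm

noncomputable def relOrder (h : Multiset ℂ) : ℕ :=
  (h.bind fun a => h.map fun b => rootOrder (a / b)).lcm

def IsMinVanishing (h : Multiset ℂ) : Prop :=
  h.sum = 0 ∧ ∀ g : Multiset ℂ, g ≤ h → g ≠ 0 → g ≠ h → g.sum ≠ 0

theorem IsRootOfUnity.ne_zero {z : ℂ} (hz : IsRootOfUnity z) : z ≠ 0 := by
  rintro rfl
  obtain ⟨n, hn, h⟩ := hz
  simp [zero_pow hn.ne'] at h

theorem IsRootOfUnity.div {z w : ℂ} (hz : IsRootOfUnity z) (hw : IsRootOfUnity w) :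
    IsRootOfUnity (z / w) := by
  obtain ⟨m, hm, h⟩ := hz
  obtain ⟨n, hn, h'⟩ := hw
  refine ⟨m * n, Nat.mul_pos hm hn, ?_⟩
  rw [div_pow, pow_mul, h, mul_comm m n, pow_mul, h', one_pow, one_pow, div_one]

theorem IsRootOfUnity.pow_rootOrder {z : ℂ} (hz : IsRootOfUnity z) : z ^ rootOrder z = 1 :=
  (Nat.sInf_mem (s := {d : ℕ | 0 < d ∧ z ^ d = 1}) hz).2

/-- Ratios of elements of a sorou are killed by every multiple of its relative order. -/
theorem IsSorou.div_pow_eq_one {h : Multiset ℂ} (hs : IsSorou h) {n : ℕ} (hn : relOrder h ∣ n)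
    {a b : ℂ} (ha : a ∈ h) (hb : b ∈ h) : (a / b) ^ n = 1 := by
  have hd : rootOrder (a / b) ∣ n := by
    refine dvd_trans (Multiset.dvd_lcm ?_) hn
    exact Multiset.mem_bind.2 ⟨a, ha, Multiset.mem_map.2 ⟨b, hb, rfl⟩⟩
  obtain ⟨k, rfl⟩ := hd
  rw [pow_mul, ((hs.2 a ha).div (hs.2 b hb)).pow_rootOrder, one_pow]

theorem IsMinVanishing.eq_of_le {g h : Multiset ℂ} (hmv : IsMinVanishing h) (hle : g ≤ h)
    (hne : g ≠ 0) (hsum : g.sum = 0) : g = h := by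
  by_contra hgh
  exact hmv.2 g hle hne hgh hsum

/-- The only rational linear relations between the powers `1, ζ, …, ζ ^ (p - 1)` of a primitive
`p`-th root of unity are the multiples of `1 + ζ + ⋯ + ζ ^ (p - 1) = 0`. -/
theorem IsPrimitiveRoot.coeff_eq_of_sum_mul_pow_eq_zero {p : ℕ} (hp : p.Prime) {ζ : ℂ}
    (hζ : IsPrimitiveRoot ζ p) (c : ℕ → ℚ)
    (hc : ∑ j ∈ Finset.range p, (c j : ℂ) * ζ ^ j = 0) {i j : ℕ} (hi : i < p) (hj : j < p) :
    c i = c j := by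
  suffices H : ∀ i < p, c i = c (p - 1) by rw [H i hi, H j hj]
  clear hi hj i j
  obtain ⟨q, rfl⟩ : ∃ q, p = q + 1 := ⟨p - 1, by have := hp.pos; omega⟩
  simp only [Nat.add_sub_cancel]
  set R : Polynomial ℚ :=
    ∑ j ∈ Finset.range q, Polynomial.monomial j (c j - c q) with hR
  have hRζ : Polynomial.aeval ζ R = 0 := by
    have hgeom := hζ.geom_sum_eq_zero hp.one_lt
    rw [Finset.sum_range_succ] at hc hgeom
    have h1 : Polynomial.aeval ζ R =
        ∑ j ∈ Finset.range q, (c j : ℂ) * ζ ^ j - c q * ∑ j ∈ Finset.range q, ζ ^ j := by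
      simp [hR, Polynomial.aeval_monomial, Finset.sum_sub_distrib, Finset.mul_sum]
    rw [h1]
    linear_combination hc - c q * hgeom
  have hdvd : Polynomial.cyclotomic (q + 1) ℚ ∣ R := by
    rw [Polynomial.cyclotomic_eq_minpoly_rat hζ hp.pos]
    exact minpoly.dvd ℚ ζ hRζ
  have hR0 : R = 0 := by
    refine Polynomial.eq_zero_of_dvd_of_degree_lt hdvd ?_
    rw [Polynomial.degree_cyclotomic, Nat.totient_prime hp, Nat.add_sub_cancel]
    refine (Polynomial.degree_sum_le _ _).trans_lt ?_
    refine (Finset.sup_lt_iff (WithBot.bot_lt_coe q)).2 fun j hj => ?_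
    exact (Polynomial.degree_monomial_le j _).trans_lt (Nat.cast_lt.2 (Finset.mem_range.1 hj))
  intro i hi
  rcases (Nat.lt_succ_iff_lt_or_eq.1 hi) with hi | rfl
  · have hcoeff := congrArg (fun P => Polynomial.coeff P i) hR0
    simp only [hR, Polynomial.finsetSum_coeff, Polynomial.coeff_monomial, Finset.sum_ite_eq',
      Finset.mem_range, hi, if_true, Polynomial.coeff_zero] at hcoeff
    linarith
  · rfl

/-- A number which is, up to sign, `ζ ^ i` with `i < p` is the corresponding signed combination
of the powers of `ζ`; summed over a multiset this expresses the sum through multiplicities. -/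
theorem sum_eq_sum_count_sub_count {p : ℕ} (hodd : Odd p) {ζ a : ℂ} (hζ : IsPrimitiveRoot ζ p)
    (ha : a ≠ 0) (h : Multiset ℂ)
    (hh : ∀ b ∈ h, ∃ i < p, b = a * ζ ^ i ∨ b = -(a * ζ ^ i)) :
    h.sum = ∑ j ∈ Finset.range p,
      ((h.count (a * ζ ^ j) : ℂ) - (h.count (-(a * ζ ^ j)) : ℂ)) * (a * ζ ^ j) := by
  have hinj : ∀ i < p, ∀ j < p, a * ζ ^ i = a * ζ ^ j → i = j := fun i hi j hj hij =>
    hζ.pow_inj hi hj (mul_left_cancel₀ ha hij)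
  have hanti : ∀ i j : ℕ, a * ζ ^ i ≠ -(a * ζ ^ j) := by
    intro i j hij
    have hij' : ζ ^ i = -ζ ^ j := mul_left_cancel₀ ha (by rw [hij, mul_neg])
    have := congrArg (· ^ p) hij'
    simp only [hodd.neg_pow, ← pow_mul, mul_comm _ p] at this
    simp only [pow_mul, hζ.pow_eq_one, one_pow] at this
    norm_num at this
  induction h using Multiset.induction_on with
  | empty => simp
  | cons b s ih =>
    rw [Multiset.sum_cons, ih fun x hx => hh x (Multiset.mem_cons_of_mem hx)]
    obtain ⟨i, hi, hb⟩ := hh b (Multiset.mem_cons_self b s)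
    have hb' : b = ∑ j ∈ Finset.range p, (((if a * ζ ^ j = b then 1 else 0 : ℕ) : ℂ) -
        ((if -(a * ζ ^ j) = b then 1 else 0 : ℕ) : ℂ)) * (a * ζ ^ j) := by
      rw [Finset.sum_eq_single_of_mem i (Finset.mem_range.2 hi)]
      · rcases hb with rfl | rfl
        · simp [(hanti i i).symm]
        · simp [hanti i i]
      · intro j hj hji
        have hne : a * ζ ^ j ≠ a * ζ ^ i := fun e => hji (hinj j (Finset.mem_range.1 hj) i hi e)
        rcases hb with rfl | rfl
        · rw [if_neg hne, if_neg (hanti i j).symm]; simp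
        · rw [if_neg (hanti j i), if_neg fun e => hne (neg_injective e)]; simp
    nth_rewrite 1 [hb']
    rw [← Finset.sum_add_distrib]
    refine Finset.sum_congr rfl fun j _ => ?_
    rw [Multiset.count_cons, Multiset.count_cons]
    push_cast
    ring

theorem stmt_5 (p : ℕ) (hp : p.Prime) (hodd : Odd p)
    (h : Multiset ℂ) (hs : IsSorou h) (hmv : IsMinVanishing h)
    (hdvd : relOrder h ∣ 2 * p) :
    (∃ z : ℂ, IsRootOfUnity z ∧ h = {z, -z}) ∨
    (∃ z : ℂ, IsRootOfUnity z ∧ h = (Multiset.range p).map (fun j => z * nu p ^ j)) := by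
  by_cases hpair : ∃ z ∈ h, -z ∈ h
  · obtain ⟨z, hz, hz'⟩ := hpair
    refine Or.inl ⟨z, hs.2 z hz, (hmv.eq_of_le ?_ (by simp) (by simp)).symm⟩
    have hne : z ≠ -z := fun e => (hs.2 z hz).ne_zero (self_eq_neg.1 e)
    refine (Multiset.le_iff_subset (by simpa using hne)).2 fun x hx => ?_
    rcases (by simpa using hx : x = z ∨ x = -z) with rfl | rfl
    exacts [hz, hz']
  · right
    push Not at hpair
    obtain ⟨a, ha⟩ := Multiset.exists_mem_of_ne_zero hs.1
    have ha0 : a ≠ 0 := (hs.2 a ha).ne_zero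
    have hζ : IsPrimitiveRoot (nu p) p := Complex.isPrimitiveRoot_exp p hp.ne_zero
    have : NeZero p := ⟨hp.ne_zero⟩
    have hh : ∀ b ∈ h, ∃ i < p, b = a * nu p ^ i ∨ b = -(a * nu p ^ i) := by
      intro b hb
      have hb1 := hs.div_pow_eq_one hdvd hb ha
      rw [mul_comm, pow_mul] at hb1
      rcases (sq_eq_sq_iff_eq_or_eq_neg (b := (1 : ℂ))).1 (hb1.trans (one_pow 2).symm) with hb1 | hb1
      · obtain ⟨i, hi, e⟩ := hζ.eq_pow_of_pow_eq_one hb1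
        exact ⟨i, hi, Or.inl (by rw [e]; field_simp)⟩
      · have hb2 : (-(b / a)) ^ p = 1 := by rw [hodd.neg_pow, hb1, neg_neg]
        obtain ⟨i, hi, e⟩ := hζ.eq_pow_of_pow_eq_one hb2
        exact ⟨i, hi, Or.inr (by rw [e]; field_simp)⟩
    have hsum := sum_eq_sum_count_sub_count hodd hζ ha0 h hh
    set c : ℕ → ℚ := fun j => h.count (a * nu p ^ j) - h.count (-(a * nu p ^ j)) with hc
    have hc0 : ∑ j ∈ Finset.range p, (c j : ℂ) * nu p ^ j = 0 := by
      refine mul_left_cancel₀ ha0 ?_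
      rw [mul_zero, ← hmv.1, hsum, Finset.mul_sum]
      refine Finset.sum_congr rfl fun j _ => ?_
      simp only [hc]
      push_cast
      ring
    have hmem : ∀ j < p, a * nu p ^ j ∈ h := by
      intro j hj
      have hcj := hζ.coeff_eq_of_sum_mul_pow_eq_zero hp c hc0 hj hp.pos
      simp only [hc, pow_zero, mul_one, Multiset.count_eq_zero_of_notMem (hpair a ha)] at hcj
      have hpos : (0 : ℚ) < h.count a := by exact_mod_cast Multiset.count_pos.2 ha
      have hnn : (0 : ℚ) ≤ h.count (-(a * nu p ^ j)) := Nat.cast_nonneg _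
      have : (0 : ℚ) < h.count (a * nu p ^ j) := by push_cast at hcj; linarith
      exact Multiset.count_pos.1 (by exact_mod_cast this)
    refine ⟨a, hs.2 a ha, (hmv.eq_of_le ?_ ?_ ?_).symm⟩
    · refine (Multiset.le_iff_subset ?_).2 fun x hx => ?_
      · refine (Multiset.nodup_range p).map_on fun i hi j hj e => ?_
        exact hζ.pow_inj (Multiset.mem_range.1 hi) (Multiset.mem_range.1 hj)
          (mul_left_cancel₀ ha0 e)
      · obtain ⟨j, hj, rfl⟩ := Multiset.mem_map.1 hx
        exact hmem j (Multiset.mem_range.1 hj)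
    · intro e
      have := congrArg Multiset.card e
      simp [hp.ne_zero] at this
    · change ∑ j ∈ Finset.range p, a * nu p ^ j = 0
      rw [← Finset.mul_sum, hζ.geom_sum_eq_zero hp.one_lt, mul_zero]
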